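/- Let (M,d,μ) be a doubling metric measure space and H_t a symmetric Markovian kernel satisfying the Chapman–Kolmogorov identity and two-sided Gaussian bounds. Let p ∈ (1,∞), q ∈ [1,∞], β ∈ ℝ and c > 0. Then there exist constants γ > 0 and C > 0 such that for all measurable functions f, g on M with T_t|f|(x) < ∞ and T_t|g|(x) < ∞ for all t > 0 and x ∈ M, one has ‖ (t,x) ↦ t^β T_{ct}( |T_t f| · |T_t g| )(x) ‖_{L^p(L^q_+)} ≤ C ‖ (t,x) ↦ t^β T_{γt}(|T_t f|)(x) · T_{γt}(|T_t g|)(x) ‖_{L^p(L^q_+)}. -/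

import Mathlib

open MeasureTheory Metric Set

variable {M : Type*} [MetricSpace M] [MeasurableSpace M]

/-- The operator `T_t` associated with a kernel `H`, with the convention `T_0 f = f`. -/
noncomputable def Tt (μ : Measure M) (H : ℝ → M → M → ℝ) (t : ℝ) (f : M → ℝ) (x : M) : ℝ :=
  if t = 0 then f x else ∫ y, H t x y * f y ∂μ

/-- The `L^q((0,∞), dt/t)` norm of a `(0,∞)`-indexed family in `[0,∞]`,
with the supremum when `q = ∞`. -/
noncomputable def qIntNorm (q : ENNReal) (G : ℝ → ENNReal) : ENNReal :=
  if q = ⊤ then ⨆ t ∈ Ioi (0 : ℝ), G t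
  else (∫⁻ t in Ioi (0 : ℝ), G t ^ q.toReal * ENNReal.ofReal t⁻¹) ^ (1 / q.toReal)

/-- The mixed norm `‖F‖_{L^p(L^q_+)}`. -/
noncomputable def LpLqNorm (μ : Measure M) (p : ℝ) (q : ENNReal) (F : ℝ → M → ℝ) : ENNReal :=
  (∫⁻ x, qIntNorm q (fun t => ENNReal.ofReal |F t x|) ^ p ∂μ) ^ (1 / p)

lemma comb_aux {H1 H2 S1 S2 C e1 e2 B E : ℝ} (hC : 0 < C) (hS1 : 0 < S1) (hB : 0 < B) (hE : 0 ≤ E)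
    (hH2 : 0 ≤ H2)
    (h1 : H1 * S1 ≤ C * e1) (h2 : C⁻¹ * e2 ≤ H2 * S2) (h3 : S2 ≤ B * S1) (h4 : e1 * B ≤ E * e2) :
    H1 ≤ C ^ 2 * E * H2 := by
  have h5 : e2 ≤ C * (H2 * S2) := by
    have := mul_le_mul_of_nonneg_left h2 hC.le
    rwa [← mul_assoc, mul_inv_cancel₀ hC.ne', one_mul] at this
  have hpos : 0 < S1 * B := by positivity
  refine le_of_mul_le_mul_right ?_ hpos
  calc H1 * (S1 * B) = H1 * S1 * B := by ring
    _ ≤ C * e1 * B := by gcongr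
    _ = C * (e1 * B) := by ring
    _ ≤ C * (E * (C * (H2 * S2))) := by
        refine mul_le_mul_of_nonneg_left (h4.trans ?_) hC.le
        exact mul_le_mul_of_nonneg_left h5 hE
    _ ≤ C * (E * (C * (H2 * (B * S1)))) := by gcongr
    _ = _ := by ring

section Kernel

variable (μ : Measure M) (c₀ D : ℝ) (H : ℝ → M → M → ℝ) (C₀ b₀ b₁ : ℝ)

lemma vol_facts (hC₀ : 0 < C₀)
    (hlower : ∀ t x y, 0 < t →
      C₀⁻¹ * Real.exp (-b₀ * dist x y ^ 2 / t) ≤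
        H t x y *
          Real.sqrt
            ((μ (ball x (Real.sqrt t))).toReal * (μ (ball y (Real.sqrt t))).toReal))
    (x : M) (r : ℝ) (hr : 0 < r) : 0 < (μ (ball x r)).toReal ∧ μ (ball x r) ≠ ⊤ := by
  have h := hlower (r ^ 2) x x (by positivity)
  rw [Real.sqrt_sq hr.le] at h
  have h1 : 0 < C₀⁻¹ * Real.exp (-b₀ * dist x x ^ 2 / r ^ 2) := by positivity
  have h2 : (μ (ball x r)).toReal ≠ 0 := by
    intro h0
    rw [h0] at h
    simp at h
    simp at h1
    linarith
  refine ⟨lt_of_le_of_ne ENNReal.toReal_nonneg h2.symm, ?_⟩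
  intro h3
  simp [h3] at h2

lemma H_pos (hC₀ : 0 < C₀)
    (hlower : ∀ t x y, 0 < t →
      C₀⁻¹ * Real.exp (-b₀ * dist x y ^ 2 / t) ≤
        H t x y *
          Real.sqrt
            ((μ (ball x (Real.sqrt t))).toReal * (μ (ball y (Real.sqrt t))).toReal))
    (t : ℝ) (x y : M) (ht : 0 < t) : 0 < H t x y := by
  have h := hlower t x y ht
  have h1 : 0 < C₀⁻¹ * Real.exp (-b₀ * dist x y ^ 2 / t) := by positivity
  exact pos_of_mul_pos_left (h1.trans_le h) (Real.sqrt_nonneg _)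

lemma vol_doub (hc₀ : 0 < c₀)
    (hdoub : ∀ (x : M) (r R : ℝ), 0 < r → 1 ≤ R →
      μ (ball x (R * r)) ≤ ENNReal.ofReal (c₀ * R ^ D) * μ (ball x r))
    (hfin : ∀ (x : M) (r : ℝ), 0 < r → 0 < (μ (ball x r)).toReal ∧ μ (ball x r) ≠ ⊤)
    (x y : M) (γ s : ℝ) (hγ : 1 ≤ γ) (hs : 0 < s) :
    (μ (ball x (Real.sqrt (γ * s)))).toReal ≤
      c₀ * (Real.sqrt γ + dist x y / Real.sqrt s) ^ D * (μ (ball y (Real.sqrt s))).toReal := by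
  have hs' : 0 < Real.sqrt s := Real.sqrt_pos.2 hs
  have hγ' : 1 ≤ Real.sqrt γ := Real.one_le_sqrt.2 hγ
  have hR : 1 ≤ Real.sqrt γ + dist x y / Real.sqrt s := by
    have : 0 ≤ dist x y / Real.sqrt s := by positivity
    linarith
  have hsub : ball x (Real.sqrt (γ * s)) ⊆
      ball y ((Real.sqrt γ + dist x y / Real.sqrt s) * Real.sqrt s) := by
    apply ball_subset_ball'
    rw [add_mul, div_mul_cancel₀ _ hs'.ne', Real.sqrt_mul (by linarith)]
  have h := (measure_mono (μ := μ) hsub).trans (hdoub y _ _ hs' hR)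
  have h2 := ENNReal.toReal_mono (ENNReal.mul_ne_top ENNReal.ofReal_ne_top (hfin y _ hs').2) h
  rwa [ENNReal.toReal_mul, ENNReal.toReal_ofReal (by positivity)] at h2

lemma rpow_bound (γ u : ℝ) (hD : 0 < D) (hγ : 1 ≤ γ) (hu : 0 ≤ u) :
    (Real.sqrt γ + u) ^ D ≤ Real.sqrt γ ^ D * Real.exp (u * D) := by
  have hγ' : 1 ≤ Real.sqrt γ := Real.one_le_sqrt.2 hγ
  have h : Real.sqrt γ + u ≤ Real.sqrt γ * Real.exp u := by
    have := Real.add_one_le_exp u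
    nlinarith
  calc (Real.sqrt γ + u) ^ D ≤ (Real.sqrt γ * Real.exp u) ^ D := by gcongr
    _ = _ := by rw [Real.mul_rpow (by positivity) (by positivity), ← Real.exp_mul]

/-- The volume factors at time `γ s` versus those at time `s`. -/
lemma vol_sqrt (hc₀ : 0 < c₀) (hD : 0 < D)
    (hdoub : ∀ (x : M) (r R : ℝ), 0 < r → 1 ≤ R →
      μ (ball x (R * r)) ≤ ENNReal.ofReal (c₀ * R ^ D) * μ (ball x r))
    (hfin : ∀ (x : M) (r : ℝ), 0 < r → 0 < (μ (ball x r)).toReal ∧ μ (ball x r) ≠ ⊤)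
    (x y w : M) (γ s : ℝ) (hγ : 1 ≤ γ) (hs : 0 < s) :
    Real.sqrt ((μ (ball x (Real.sqrt (γ * s)))).toReal * (μ (ball w (Real.sqrt (γ * s)))).toReal) ≤
      (c₀ * Real.sqrt γ ^ D * Real.exp (dist x y / Real.sqrt s * D / 2)) *
      Real.sqrt ((μ (ball y (Real.sqrt s))).toReal * (μ (ball w (Real.sqrt s))).toReal) := by
  have hs' : 0 < Real.sqrt s := Real.sqrt_pos.2 hs
  have h1 := vol_doub μ c₀ D hc₀ hdoub hfin x y γ s hγ hs
  have h2 := vol_doub μ c₀ D hc₀ hdoub hfin w w γ s hγ hs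
  have h3 := rpow_bound D γ (dist x y / Real.sqrt s) hD hγ (by positivity)
  rw [dist_self, zero_div, add_zero] at h2
  set Vy := (μ (ball y (Real.sqrt s))).toReal
  set Vw := (μ (ball w (Real.sqrt s))).toReal
  have hVy : 0 ≤ Vy := ENNReal.toReal_nonneg
  have hVw : 0 ≤ Vw := ENNReal.toReal_nonneg
  set u := dist x y / Real.sqrt s
  have hB : 0 ≤ c₀ * Real.sqrt γ ^ D * Real.exp (u * D / 2) := by positivity
  rw [← Real.sqrt_sq hB, ← Real.sqrt_mul (sq_nonneg _)]
  apply Real.sqrt_le_sqrt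
  have he : Real.exp (u * D) = Real.exp (u * D / 2) ^ 2 := by
    rw [← Real.exp_nat_mul]; congr 1; push_cast; ring
  calc _ ≤ (c₀ * (Real.sqrt γ ^ D * Real.exp (u * D)) * Vy) * (c₀ * Real.sqrt γ ^ D * Vw) := by
        refine mul_le_mul (h1.trans ?_) h2 ENNReal.toReal_nonneg (by positivity)
        gcongr
    _ = _ := by rw [he]; ring

lemma kernelA (hc₀ : 0 < c₀) (hD : 0 < D)
    (hdoub : ∀ (x : M) (r R : ℝ), 0 < r → 1 ≤ R →
      μ (ball x (R * r)) ≤ ENNReal.ofReal (c₀ * R ^ D) * μ (ball x r))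
    (hC₀ : 0 < C₀) (hb₀ : 0 < b₀) (hb₁ : 0 < b₁)
    (hlower : ∀ t x y, 0 < t →
      C₀⁻¹ * Real.exp (-b₀ * dist x y ^ 2 / t) ≤
        H t x y *
          Real.sqrt
            ((μ (ball x (Real.sqrt t))).toReal * (μ (ball y (Real.sqrt t))).toReal))
    (hupper : ∀ t x y, 0 < t →
      H t x y *
          Real.sqrt
            ((μ (ball x (Real.sqrt t))).toReal * (μ (ball y (Real.sqrt t))).toReal) ≤
        C₀ * Real.exp (-b₁ * dist x y ^ 2 / t))
    (ε : ℝ) (hε : 0 < ε) :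
    ∃ γ C : ℝ, 1 ≤ γ ∧ 0 < C ∧ ∀ s x y w, 0 < s →
      H s y w ≤ C * Real.exp (ε * dist x y ^ 2 / s) * H (γ * s) x w := by
  have hfin := vol_facts μ H C₀ b₀ hC₀ hlower
  have hpos := H_pos μ H C₀ b₀ hC₀ hlower
  set K : ℝ := 2 * b₁ / ε with hK
  have hKpos : 0 < K := by positivity
  set γ : ℝ := max 1 (b₀ * (1 + K) / b₁) with hγdef
  have hγ : 1 ≤ γ := le_max_left _ _
  have hγ0 : 0 < γ := by linarith
  have hγ2 : b₀ / γ ≤ b₁ / (1 + K) := by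
    have : b₀ * (1 + K) / b₁ ≤ γ := le_max_right _ _
    rw [div_le_iff₀ hb₁] at this
    rw [div_le_div_iff₀ hγ0 (by positivity)]
    linarith
  refine ⟨γ, C₀ ^ 2 * (c₀ * Real.sqrt γ ^ D * Real.exp (D ^ 2 / (8 * ε))), hγ, by positivity, ?_⟩
  intro s x y w hs
  have hs' : 0 < Real.sqrt s := Real.sqrt_pos.2 hs
  have hv := vol_sqrt μ c₀ D hc₀ hD hdoub hfin x y w γ s hγ hs
  have h := comb_aux (E := c₀ * Real.sqrt γ ^ D * Real.exp (D ^ 2 / (8 * ε)) *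
    Real.exp (ε * dist x y ^ 2 / s)) hC₀
    (Real.sqrt_pos.2 (mul_pos (hfin y _ hs').1 (hfin w _ hs').1)) (by positivity) (by positivity)
    (hpos (γ * s) x w (by positivity)).le (hupper s y w hs) (hlower (γ * s) x w (by positivity)) hv ?_
  · calc _ ≤ _ := h
      _ = _ := by ring
  · have key : -b₁ * dist y w ^ 2 / s + dist x y / Real.sqrt s * D / 2 ≤
        D ^ 2 / (8 * ε) + ε * dist x y ^ 2 / s + (-b₀ * dist x w ^ 2 / (γ * s)) := by
      set u := dist x y / Real.sqrt s with hu
      have hu2 : dist x y ^ 2 / s = u ^ 2 := by rw [hu, div_pow, Real.sq_sqrt hs.le]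
      have e1 : u * D / 2 ≤ ε / 2 * u ^ 2 + D ^ 2 / (8 * ε) := by
        have : 0 ≤ (2 * ε * u - D) ^ 2 / (8 * ε) := by positivity
        have e : (2 * ε * u - D) ^ 2 / (8 * ε) = ε / 2 * u ^ 2 + D ^ 2 / (8 * ε) - u * D / 2 := by
          field_simp; ring
        linarith
      have tri : dist x w ≤ dist x y + dist y w := dist_triangle _ _ _
      have e2 : dist x w ^ 2 ≤ (1 + K) * dist y w ^ 2 + (1 + 1 / K) * dist x y ^ 2 := by
        have a1 : dist x w ^ 2 ≤ (dist x y + dist y w) ^ 2 := by gcongr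
        have a2 : 0 ≤ (K * dist y w - dist x y) ^ 2 / K := by positivity
        have a3 : (K * dist y w - dist x y) ^ 2 / K =
          K * dist y w ^ 2 + 1 / K * dist x y ^ 2 - 2 * dist y w * dist x y := by
          field_simp; ring
        nlinarith
      have e3 : b₁ / (1 + K) * dist x w ^ 2 ≤ b₁ * dist y w ^ 2 + ε / 2 * dist x y ^ 2 := by
        have : b₁ / (1 + K) * dist x w ^ 2 ≤
          b₁ / (1 + K) * ((1 + K) * dist y w ^ 2 + (1 + 1 / K) * dist x y ^ 2) := by gcongr
        refine this.trans (le_of_eq ?_)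
        have : ε = 2 * b₁ / K := by rw [hK]; field_simp
        rw [this]; field_simp; ring
      have e4 : b₀ / γ * dist x w ^ 2 ≤ b₁ * dist y w ^ 2 + ε / 2 * dist x y ^ 2 :=
        le_trans (by gcongr) e3
      have e5 : b₀ / γ * dist x w ^ 2 / s ≤ (b₁ * dist y w ^ 2 + ε / 2 * dist x y ^ 2) / s := by
        gcongr
      have e6 : -b₀ * dist x w ^ 2 / (γ * s) = - (b₀ / γ * dist x w ^ 2 / s) := by field_simp
      have e7 : (b₁ * dist y w ^ 2 + ε / 2 * dist x y ^ 2) / s =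
        b₁ * dist y w ^ 2 / s + ε / 2 * (dist x y ^ 2 / s) := by ring
      have e8 : -b₁ * dist y w ^ 2 / s = -(b₁ * dist y w ^ 2 / s) := by ring
      have e9 : ε * dist x y ^ 2 / s = ε * (dist x y ^ 2 / s) := by ring
      rw [e6, e8, e9]
      rw [e7] at e5
      rw [hu2] at e5 ⊢
      linarith
    have := Real.exp_le_exp.2 key
    rw [Real.exp_add, Real.exp_add, Real.exp_add] at this
    have hc : 0 ≤ c₀ * Real.sqrt γ ^ D := by positivity
    have := mul_le_mul_of_nonneg_left this hc
    calc _ = _ := ?_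
      _ ≤ _ := this
      _ = _ := by ring
    ring

lemma kernelB (hc₀ : 0 < c₀) (hD : 0 < D)
    (hdoub : ∀ (x : M) (r R : ℝ), 0 < r → 1 ≤ R →
      μ (ball x (R * r)) ≤ ENNReal.ofReal (c₀ * R ^ D) * μ (ball x r))
    (hC₀ : 0 < C₀) (hb₀ : 0 < b₀) (hb₁ : 0 < b₁)
    (hlower : ∀ t x y, 0 < t →
      C₀⁻¹ * Real.exp (-b₀ * dist x y ^ 2 / t) ≤
        H t x y *
          Real.sqrt
            ((μ (ball x (Real.sqrt t))).toReal * (μ (ball y (Real.sqrt t))).toReal))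
    (hupper : ∀ t x y, 0 < t →
      H t x y *
          Real.sqrt
            ((μ (ball x (Real.sqrt t))).toReal * (μ (ball y (Real.sqrt t))).toReal) ≤
        C₀ * Real.exp (-b₁ * dist x y ^ 2 / t)) :
    ∃ γ C : ℝ, 1 ≤ γ ∧ 0 < C ∧ ∀ s x y, 0 < s →
      H s x y * Real.exp (b₁ / 2 * dist x y ^ 2 / s) ≤ C * H (γ * s) x y := by
  have hfin := vol_facts μ H C₀ b₀ hC₀ hlower
  have hpos := H_pos μ H C₀ b₀ hC₀ hlower
  set γ : ℝ := max 1 (2 * b₀ / b₁) with hγdef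
  have hγ : 1 ≤ γ := le_max_left _ _
  have hγ0 : 0 < γ := by linarith
  have hγ2 : b₀ / γ ≤ b₁ / 2 := by
    have : 2 * b₀ / b₁ ≤ γ := le_max_right _ _
    rw [div_le_iff₀ hb₁] at this
    rw [div_le_div_iff₀ hγ0 (by positivity)]
    linarith
  refine ⟨γ, C₀ ^ 2 * (c₀ * Real.sqrt γ ^ D), hγ, by positivity, ?_⟩
  intro s x y hs
  have hs' : 0 < Real.sqrt s := Real.sqrt_pos.2 hs
  have hv := vol_sqrt μ c₀ D hc₀ hD hdoub hfin x x y γ s hγ hs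
  rw [dist_self, zero_div, zero_mul, zero_div, Real.exp_zero, mul_one] at hv
  refine comb_aux (e1 := Real.exp (-b₁ * dist x y ^ 2 / s) * Real.exp (b₁ / 2 * dist x y ^ 2 / s))
    hC₀ (Real.sqrt_pos.2 (mul_pos (hfin x _ hs').1 (hfin y _ hs').1)) (by positivity) (by positivity)
    (hpos (γ * s) x y (by positivity)).le ?_ (hlower (γ * s) x y (by positivity)) hv ?_
  · have := mul_le_mul_of_nonneg_right (hupper s x y hs)
      (Real.exp_pos (b₁ / 2 * dist x y ^ 2 / s)).le
    linarith
  · rw [← Real.exp_add, mul_comm]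
    gcongr
    have e4 : b₀ / γ * dist x y ^ 2 / s ≤ b₁ / 2 * dist x y ^ 2 / s := by gcongr
    have e6 : -b₀ * dist x y ^ 2 / (γ * s) = - (b₀ / γ * dist x y ^ 2 / s) := by field_simp
    have e7 : -b₁ * dist x y ^ 2 / s + b₁ / 2 * dist x y ^ 2 / s =
      -(b₁ / 2 * dist x y ^ 2 / s) := by ring
    linarith

lemma sigmaFinite_aux [Nonempty M]
    (hfin : ∀ (x : M) (r : ℝ), 0 < r → 0 < (μ (ball x r)).toReal ∧ μ (ball x r) ≠ ⊤) :
    SigmaFinite μ := by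
  obtain ⟨x⟩ := ‹Nonempty M›
  refine ⟨⟨⟨fun n : ℕ => ball x (n + 1), fun _ => mem_univ _,
    fun n => (hfin x _ (by positivity)).2.lt_top, ?_⟩⟩⟩
  rw [eq_univ_iff_forall]
  intro y
  obtain ⟨n, hn⟩ := exists_nat_gt (dist y x)
  exact mem_iUnion.2 ⟨n, by rw [mem_ball]; linarith⟩

lemma semigroup_int [SigmaFinite μ]
    (hHmeas : Measurable fun p : ℝ × M × M => H p.1 p.2.1 p.2.2)
    (hpos : ∀ t x y, 0 < t → 0 < H t x y)
    (hck : ∀ s t x y, 0 < s → 0 < t →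
      ∫ z, H s x z * H t z y ∂μ = H (s + t) x y)
    (f : M → ℝ) (hf : Measurable f)
    (hfi : ∀ t x, 0 < t → Integrable (fun y => H t x y * |f y|) μ)
    (a b : ℝ) (ha : 0 < a) (hb : 0 < b) (x : M) :
    Integrable (fun p : M × M => H a x p.1 * (H b p.1 p.2 * f p.2)) (μ.prod μ) := by
  have hm : Measurable (fun p : M × M => H a x p.1 * (H b p.1 p.2 * f p.2)) := by
    have h1 : Measurable (fun p : M × M => H a x p.1) :=
      hHmeas.comp (measurable_const.prodMk (measurable_const.prodMk measurable_fst))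
    have h2 : Measurable (fun p : M × M => H b p.1 p.2) :=
      hHmeas.comp (measurable_const.prodMk (measurable_fst.prodMk measurable_snd))
    exact h1.mul (h2.mul (hf.comp measurable_snd))
  rw [integrable_prod_iff' hm.aestronglyMeasurable]
  have hint : ∀ w, Integrable (fun z => H a x z * H b z w) μ := by
    intro w
    by_contra h
    have := hck a b x w ha hb
    rw [integral_undef h] at this
    exact (hpos (a + b) x w (by positivity)).ne this
  constructor
  · refine Filter.Eventually.of_forall fun w => ?_
    refine ((hint w).mul_const (f w)).congr (Filter.Eventually.of_forall fun z => ?_)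
    simp only; ring
  · refine (hfi (a + b) x (by positivity)).congr (Filter.Eventually.of_forall fun w => ?_)
    simp only
    rw [← hck a b x w ha hb, ← integral_mul_const]
    refine integral_congr_ae (Filter.Eventually.of_forall fun z => ?_)
    simp only [Real.norm_eq_abs, abs_mul, abs_of_pos (hpos a x z ha), abs_of_pos (hpos b z w hb)]
    ring

lemma Tt_int [SigmaFinite μ]
    (hHmeas : Measurable fun p : ℝ × M × M => H p.1 p.2.1 p.2.2)
    (hpos : ∀ t x y, 0 < t → 0 < H t x y)
    (hck : ∀ s t x y, 0 < s → 0 < t →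
      ∫ z, H s x z * H t z y ∂μ = H (s + t) x y)
    (f : M → ℝ) (hf : Measurable f)
    (hfi : ∀ t x, 0 < t → Integrable (fun y => H t x y * |f y|) μ)
    (a b : ℝ) (ha : 0 < a) (hb : 0 < b) (x : M) :
    Integrable (fun z => H a x z * |Tt μ H b f z|) μ := by
  have h := (semigroup_int μ H hHmeas hpos hck f hf hfi a b ha hb x).integral_prod_left.norm
  refine h.congr (Filter.Eventually.of_forall fun z => ?_)
  simp only [Tt, hb.ne', if_false, integral_const_mul, Real.norm_eq_abs, abs_mul,
    abs_of_pos (hpos a x z ha)]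

lemma Tt_semigroup [SigmaFinite μ]
    (hHmeas : Measurable fun p : ℝ × M × M => H p.1 p.2.1 p.2.2)
    (hpos : ∀ t x y, 0 < t → 0 < H t x y)
    (hck : ∀ s t x y, 0 < s → 0 < t →
      ∫ z, H s x z * H t z y ∂μ = H (s + t) x y)
    (f : M → ℝ) (hf : Measurable f)
    (hfi : ∀ t x, 0 < t → Integrable (fun y => H t x y * |f y|) μ)
    (a b : ℝ) (ha : 0 < a) (hb : 0 < b) (x : M) :
    |Tt μ H (a + b) f x| ≤ ∫ z, H a x z * |Tt μ H b f z| ∂μ := by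
  have hab : a + b ≠ 0 := by positivity
  have h := integral_integral_swap (f := fun z w => H a x z * (H b z w * f w))
    (semigroup_int μ H hHmeas hpos hck f hf hfi a b ha hb x)
  have e : Tt μ H (a + b) f x = ∫ z, H a x z * Tt μ H b f z ∂μ := by
    simp only [Tt, hb.ne', hab, if_false]
    simp only [integral_const_mul] at h
    rw [h]
    refine integral_congr_ae (Filter.Eventually.of_forall fun w => ?_)
    simp only
    rw [← hck a b x w ha hb, ← integral_mul_const]
    refine integral_congr_ae (Filter.Eventually.of_forall fun z => ?_)
    simp only; ring
  rw [e]
  refine (abs_integral_le_integral_abs).trans (le_of_eq ?_)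
  refine integral_congr_ae (Filter.Eventually.of_forall fun z => ?_)
  simp only [abs_mul, abs_of_pos (hpos a x z ha)]

end Kernel

lemma qIntNorm_scale (q : ENNReal) (hq : 1 ≤ q) (K : ENNReal) (hK : K ≠ ⊤) (G G' : ℝ → ENNReal)
    (h : ∀ s, 0 < s → G (2 * s) ≤ K * G' s) : qIntNorm q G ≤ K * qIntNorm q G' := by
  unfold qIntNorm
  split_ifs with hqt
  · refine iSup₂_le fun t ht => ?_
    have ht' : (0:ℝ) < t / 2 := by have : (0:ℝ) < t := ht; positivity
    have h1 := h (t / 2) ht'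
    rw [mul_div_cancel₀ t two_ne_zero] at h1
    refine h1.trans ?_
    gcongr
    exact le_iSup₂ (f := fun t (_ : t ∈ Ioi (0:ℝ)) => G' t) (t / 2) ht'
  · have hq0 : 0 < q.toReal := ENNReal.toReal_pos (by positivity) hqt
    have e : ∫⁻ t in Ioi (0 : ℝ), G t ^ q.toReal * ENNReal.ofReal t⁻¹ =
        ∫⁻ s in Ioi (0 : ℝ), G (2 * s) ^ q.toReal * ENNReal.ofReal s⁻¹ := by
      have hmap := Real.smul_map_volume_mul_left (a := 2) two_ne_zero
      have hemb : MeasurableEmbedding (fun s : ℝ => 2 * s) :=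
        (Homeomorph.mulLeft₀ (2:ℝ) two_ne_zero).measurableEmbedding
      rw [← lintegral_indicator measurableSet_Ioi, ← lintegral_indicator measurableSet_Ioi]
      conv_lhs => rw [← hmap]
      rw [lintegral_smul_measure, hemb.lintegral_map, smul_eq_mul,
        ← lintegral_const_mul' _ _ ENNReal.ofReal_ne_top]
      refine lintegral_congr fun s => ?_
      by_cases hs : 0 < s
      · rw [indicator_of_mem (by simpa using hs), indicator_of_mem (by simpa using hs)]
        rw [mul_left_comm, ← ENNReal.ofReal_mul (by positivity)]
        congr 2
        rw [abs_of_pos two_pos]; field_simp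
      · rw [indicator_of_notMem (by simpa using hs), indicator_of_notMem (by simpa using hs),
          mul_zero]
    rw [e]
    have hle : ∫⁻ s in Ioi (0 : ℝ), G (2 * s) ^ q.toReal * ENNReal.ofReal s⁻¹ ≤
        K ^ q.toReal * ∫⁻ s in Ioi (0 : ℝ), G' s ^ q.toReal * ENNReal.ofReal s⁻¹ := by
      rw [← lintegral_const_mul' _ _ (ENNReal.rpow_ne_top_of_nonneg hq0.le hK)]
      refine setLIntegral_mono' measurableSet_Ioi fun s hs => ?_
      rw [← mul_assoc, ← ENNReal.mul_rpow_of_nonneg _ _ hq0.le]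
      gcongr
      exact h s hs
    calc _ ≤ (K ^ q.toReal * ∫⁻ s in Ioi (0 : ℝ), G' s ^ q.toReal * ENNReal.ofReal s⁻¹)
          ^ (1 / q.toReal) := by gcongr
      _ = _ := by
        rw [ENNReal.mul_rpow_of_nonneg _ _ (by positivity), ← ENNReal.rpow_mul,
          mul_one_div_cancel hq0.ne', ENNReal.rpow_one]

lemma LpLqNorm_scale (μ : Measure M) (p : ℝ) (hp : 0 < p) (q : ENNReal) (hq : 1 ≤ q) (K : ℝ)
    (hK : 0 < K) (F F' : ℝ → M → ℝ)
    (h : ∀ s x, 0 < s → |F (2 * s) x| ≤ K * |F' s x|) :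
    LpLqNorm μ p q F ≤ ENNReal.ofReal K * LpLqNorm μ p q F' := by
  unfold LpLqNorm
  have hle : ∫⁻ x, qIntNorm q (fun t => ENNReal.ofReal |F t x|) ^ p ∂μ ≤
      ENNReal.ofReal K ^ p * ∫⁻ x, qIntNorm q (fun t => ENNReal.ofReal |F' t x|) ^ p ∂μ := by
    rw [← lintegral_const_mul' _ _ (ENNReal.rpow_ne_top_of_nonneg hp.le ENNReal.ofReal_ne_top)]
    refine lintegral_mono fun x => ?_
    simp only
    rw [← ENNReal.mul_rpow_of_nonneg _ _ hp.le]
    gcongr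
    refine qIntNorm_scale q hq _ ENNReal.ofReal_ne_top _ _ fun s hs => ?_
    rw [← ENNReal.ofReal_mul hK.le]
    exact ENNReal.ofReal_le_ofReal (h s x hs)
  calc _ ≤ (ENNReal.ofReal K ^ p * ∫⁻ x, qIntNorm q (fun t => ENNReal.ofReal |F' t x|) ^ p ∂μ)
        ^ (1 / p) := by gcongr
    _ = _ := by
      rw [ENNReal.mul_rpow_of_nonneg _ _ (by positivity), ← ENNReal.rpow_mul,
        mul_one_div_cancel hp.ne', ENNReal.rpow_one]

/-- Second part of Corollary `bilinearCRTNint` of the paper: for `p ∈ (1,∞)`, `q ∈ [1,∞]`,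
`β ∈ ℝ` and `c > 0` there are `γ > 0` and `C > 0` such that for measurable `f, g` with
finite `T_t|f|, T_t|g|`,
`‖t^β T_{ct}(|T_t f|·|T_t g|)‖_{L^p(L^q_+)} ≤ C ‖t^β T_{γt}(|T_t f|)·T_{γt}(|T_t g|)‖_{L^p(L^q_+)}`. -/
theorem stmt_16 (μ : Measure M)
    (c₀ D : ℝ) (hc₀ : 0 < c₀) (hD : 0 < D)
    (hdoub : ∀ (x : M) (r R : ℝ), 0 < r → 1 ≤ R →
      μ (ball x (R * r)) ≤ ENNReal.ofReal (c₀ * R ^ D) * μ (ball x r))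
    (H : ℝ → M → M → ℝ)
    (hHmeas : Measurable fun p : ℝ × M × M => H p.1 p.2.1 p.2.2)
    (hHnonneg : ∀ t x y, 0 < t → 0 ≤ H t x y)
    (hHsymm : ∀ t x y, 0 < t → H t x y = H t y x)
    (hmarkov : ∀ t x, 0 < t → ∫⁻ y, ENNReal.ofReal (H t x y) ∂μ = 1)
    (hck : ∀ s t x y, 0 < s → 0 < t →
      ∫ z, H s x z * H t z y ∂μ = H (s + t) x y)
    (C₀ b₀ b₁ : ℝ) (hC₀ : 0 < C₀) (hb₀ : 0 < b₀) (hb₁ : 0 < b₁)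
    (hlower : ∀ t x y, 0 < t →
      C₀⁻¹ * Real.exp (-b₀ * dist x y ^ 2 / t) ≤
        H t x y *
          Real.sqrt
            ((μ (ball x (Real.sqrt t))).toReal * (μ (ball y (Real.sqrt t))).toReal))
    (hupper : ∀ t x y, 0 < t →
      H t x y *
          Real.sqrt
            ((μ (ball x (Real.sqrt t))).toReal * (μ (ball y (Real.sqrt t))).toReal) ≤
        C₀ * Real.exp (-b₁ * dist x y ^ 2 / t))
    (p : ℝ) (hp1 : 1 < p) (q : ENNReal) (hq : 1 ≤ q) (β : ℝ) (c : ℝ) (hc : 0 < c) :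
    ∃ γ C : ℝ, 0 < γ ∧ 0 < C ∧
      ∀ f g : M → ℝ, Measurable f → Measurable g →
        (∀ t x, 0 < t → Integrable (fun y => H t x y * |f y|) μ) →
        (∀ t x, 0 < t → Integrable (fun y => H t x y * |g y|) μ) →
        LpLqNorm μ p q
            (fun t x => t ^ β *
              Tt μ H (c * t) (fun y => |Tt μ H t f y| * |Tt μ H t g y|) x) ≤
          ENNReal.ofReal C *
            LpLqNorm μ p q
              (fun t x => t ^ β *
                (Tt μ H (γ * t) (fun y => |Tt μ H t f y|) x *
                  Tt μ H (γ * t) (fun y => |Tt μ H t g y|) x)) := by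
  have hfin := vol_facts μ H C₀ b₀ hC₀ hlower
  have hpos := H_pos μ H C₀ b₀ hC₀ hlower
  obtain ⟨γ, A, hγ, hA, hkA⟩ := kernelA μ c₀ D H C₀ b₀ b₁ hc₀ hD hdoub hC₀ hb₀ hb₁ hlower hupper
    (b₁ / (8 * c)) (by positivity)
  obtain ⟨γ', B, hγ', hB, hkB⟩ := kernelB μ c₀ D H C₀ b₀ b₁ hc₀ hD hdoub hC₀ hb₀ hb₁ hlower hupper
  have hγ0 : 0 < γ := by linarith
  have hγ'0 : 0 < γ' := by linarith
  refine ⟨γ, 2 ^ β * (A ^ 2 * B), hγ0, by positivity, ?_⟩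
  intro f g hf hg hfi hgi
  refine LpLqNorm_scale μ p (by linarith) q hq _ (by positivity) _ _ fun s x hs => ?_
  have : Nonempty M := ⟨x⟩
  have : SigmaFinite μ := sigmaFinite_aux μ hfin
  have hγs : 0 < γ * s := by positivity
  -- pointwise comparison
  have key : ∀ f : M → ℝ, Measurable f →
      (∀ t x, 0 < t → Integrable (fun y => H t x y * |f y|) μ) → ∀ y,
      |Tt μ H (2 * s) f y| ≤ A * Real.exp (b₁ / (8 * c) * dist x y ^ 2 / s) *
        Tt μ H (γ * s) (fun z => |Tt μ H s f z|) x := by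
    intro f hf hfi y
    have h1 := Tt_semigroup μ H hHmeas hpos hck f hf hfi s s hs hs y
    rw [← two_mul] at h1
    refine h1.trans ?_
    have e0 : Tt μ H (γ * s) (fun z => |Tt μ H s f z|) x =
        ∫ z, H (γ * s) x z * |Tt μ H s f z| ∂μ := by rw [Tt, if_neg hγs.ne']
    rw [e0, ← integral_const_mul]
    refine integral_mono (Tt_int μ H hHmeas hpos hck f hf hfi s s hs hs y)
      ((Tt_int μ H hHmeas hpos hck f hf hfi (γ * s) s hγs hs x).const_mul _) fun z => ?_
    have := mul_le_mul_of_nonneg_right (hkA s x y z hs) (abs_nonneg (Tt μ H s f z))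
    simp only
    linarith
  have hPnn : ∀ f : M → ℝ, 0 ≤ Tt μ H (γ * s) (fun z => |Tt μ H s f z|) x := by
    intro f
    rw [Tt, if_neg hγs.ne']
    exact integral_nonneg fun z => mul_nonneg (hpos _ _ _ hγs).le (abs_nonneg _)
  set P := Tt μ H (γ * s) (fun z => |Tt μ H s f z|) x with hP
  set Q := Tt μ H (γ * s) (fun z => |Tt μ H s g z|) x with hQ
  have hP0 : 0 ≤ P := hPnn f
  have hQ0 : 0 ≤ Q := hPnn g
  have hcs : 0 < c * (2 * s) := by positivity
  have hcs' : 0 < γ' * (c * (2 * s)) := by positivity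
  have hHm : Measurable (H (γ' * (c * (2 * s))) x) :=
    hHmeas.comp (measurable_const.prodMk (measurable_const.prodMk measurable_id))
  have hHint : Integrable (H (γ' * (c * (2 * s))) x) μ := by
    refine ⟨hHm.aestronglyMeasurable, ?_⟩
    rw [hasFiniteIntegral_iff_ofReal (Filter.Eventually.of_forall fun z => (hpos _ x z hcs').le),
      hmarkov _ _ hcs']
    exact ENNReal.one_lt_top
  have hHone : ∫ y, H (γ' * (c * (2 * s))) x y ∂μ = 1 := by
    rw [integral_eq_lintegral_of_nonneg_ae
      (Filter.Eventually.of_forall fun z => (hpos _ x z hcs').le) hHm.aestronglyMeasurable,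
      hmarkov _ _ hcs', ENNReal.toReal_one]
  have main : Tt μ H (c * (2 * s)) (fun y => |Tt μ H (2 * s) f y| * |Tt μ H (2 * s) g y|) x ≤
      A ^ 2 * B * (P * Q) := by
    have e : A ^ 2 * B * (P * Q) =
        ∫ y, A ^ 2 * B * (P * Q) * H (γ' * (c * (2 * s))) x y ∂μ := by
      rw [integral_const_mul, hHone, mul_one]
    rw [Tt, if_neg hcs.ne', e]
    refine integral_mono_of_nonneg (Filter.Eventually.of_forall fun y => ?_)
      (hHint.const_mul _) (Filter.Eventually.of_forall fun y => ?_)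
    · exact mul_nonneg (hpos _ _ _ hcs).le (mul_nonneg (abs_nonneg _) (abs_nonneg _))
    · simp only
      have h1 := key f hf hfi y
      have h2 := key g hg hgi y
      have h3 := hkB (c * (2 * s)) x y hcs
      have hexp : Real.exp (b₁ / 2 * dist x y ^ 2 / (c * (2 * s))) =
          Real.exp (b₁ / (8 * c) * dist x y ^ 2 / s) * Real.exp (b₁ / (8 * c) * dist x y ^ 2 / s) := by
        rw [← Real.exp_add]; congr 1; field_simp; ring
      rw [hexp] at h3
      set E := Real.exp (b₁ / (8 * c) * dist x y ^ 2 / s)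
      have hE : 0 < E := Real.exp_pos _
      have hH0 := (hpos _ x y hcs).le
      calc _ ≤ H (c * (2 * s)) x y * ((A * E * P) * (A * E * Q)) := by
            gcongr
        _ = A ^ 2 * (P * Q) * (H (c * (2 * s)) x y * (E * E)) := by ring
        _ ≤ A ^ 2 * (P * Q) * (B * H (γ' * (c * (2 * s))) x y) := by gcongr
        _ = _ := by ring
  have hL0 : 0 ≤ Tt μ H (c * (2 * s)) (fun y => |Tt μ H (2 * s) f y| * |Tt μ H (2 * s) g y|) x := by
    rw [Tt, if_neg hcs.ne']
    exact integral_nonneg fun y =>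
      mul_nonneg (hpos _ _ _ hcs).le (mul_nonneg (abs_nonneg _) (abs_nonneg _))
  rw [abs_of_nonneg (by positivity), abs_of_nonneg (by positivity),
    Real.mul_rpow two_pos.le hs.le]
  calc _ ≤ 2 ^ β * s ^ β * (A ^ 2 * B * (P * Q)) := by gcongr
    _ = _ := by ring
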